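/- arXiv:2203.05273 — 3 statements merged into one kernel-verified Lean document; each statement's English description precedes it below -/
import Mathlib

section
/- Let a > 0 and b ∈ ℝ, and let c ∈ ℂ be any complex number with c² = 1 − b² − 4a − 2ib. Then the set of complex eigenvalues of M_{a,b} (viewed as a complex matrix) is exactly {½(1 − ib − c), ½(1 − ib + c), ½(1 + ib − c̄), ½(1 + ib + c̄)}, where c̄ is the complex conjugate of c. -/
open Matrix Polynomial

/-- The matrix `M_{a,b}` of the quadratic Kramers-Fokker-Planck operator with magnetic field. -/
noncomputable def Mab (a b : ℝ) : Matrix (Fin 4) (Fin 4) ℝ :=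
  !![1, b, Real.sqrt a, 0;
     -b, 1, 0, Real.sqrt a;
     -Real.sqrt a, 0, 0, 0;
     0, -Real.sqrt a, 0, 0]

/-- `M_{a,b}` viewed as a complex matrix. -/
noncomputable def MabC (a b : ℝ) : Matrix (Fin 4) (Fin 4) ℂ :=
  (Mab a b).map Complex.ofReal

/-- The characteristic determinant of `M_{a,b}` factors into two conjugate quadratics. -/
theorem det_scalar_sub_MabC (a b : ℝ) (ha : 0 ≤ a) (z : ℂ) :
    (algebraMap ℂ (Matrix (Fin 4) (Fin 4) ℂ) z - MabC a b).det =
      (z ^ 2 - (1 - Complex.I * b) * z + a) * (z ^ 2 - (1 + Complex.I * b) * z + a) := by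
  have hs : (Real.sqrt a : ℂ) ^ 2 = a := by
    rw [← Complex.ofReal_pow, Real.sq_sqrt ha]
  have hM : algebraMap ℂ (Matrix (Fin 4) (Fin 4) ℂ) z - MabC a b =
      !![z - 1, -(b : ℂ), -(Real.sqrt a : ℂ), 0;
         (b : ℂ), z - 1, 0, -(Real.sqrt a : ℂ);
         (Real.sqrt a : ℂ), 0, z, 0;
         0, (Real.sqrt a : ℂ), 0, z] := by
    ext i j
    fin_cases i <;> fin_cases j <;>
      simp [MabC, Mab, Matrix.algebraMap_matrix_apply]
  rw [hM, ← hs]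
  simp [Matrix.det_succ_row_zero, Fin.sum_univ_succ, Fin.succAbove]
  linear_combination ((b : ℂ) ^ 2 * z ^ 2) * Complex.I_sq

/-- A monic quadratic with linear coefficient `-p` and discriminant `c ^ 2` has
roots `(p ± c) / 2`. -/
theorem monic_quadratic_eq_zero_iff {p q c : ℂ} (hc : c ^ 2 = p ^ 2 - 4 * q) (z : ℂ) :
    z ^ 2 - p * z + q = 0 ↔ z = (p - c) / 2 ∨ z = (p + c) / 2 := by
  have h : z ^ 2 - p * z + q = (z - (p - c) / 2) * (z - (p + c) / 2) := by
    linear_combination hc / 4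
  rw [h, mul_eq_zero, sub_eq_zero, sub_eq_zero]

/-- For `a > 0`, `b ∈ ℝ` and any `c ∈ ℂ` with `c² = 1 - b² - 4a - 2ib`, the set of complex
eigenvalues of `M_{a,b}` is `{½(1-ib-c), ½(1-ib+c), ½(1+ib-c̄), ½(1+ib+c̄)}`. -/
theorem stmt_1 (a b : ℝ) (ha : 0 < a) (c : ℂ)
    (hc : c ^ 2 = 1 - (b : ℂ) ^ 2 - 4 * (a : ℂ) - 2 * Complex.I * (b : ℂ)) :
    spectrum ℂ (MabC a b) =
      {(1 - Complex.I * (b : ℂ) - c) / 2, (1 - Complex.I * (b : ℂ) + c) / 2,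
       (1 + Complex.I * (b : ℂ) - (starRingEnd ℂ) c) / 2,
       (1 + Complex.I * (b : ℂ) + (starRingEnd ℂ) c) / 2} := by
  have hc₁ : c ^ 2 = (1 - Complex.I * (b : ℂ)) ^ 2 - 4 * (a : ℂ) := by
    linear_combination hc - (b : ℂ) ^ 2 * Complex.I_sq
  have hc₂ : (starRingEnd ℂ) c ^ 2 = (1 + Complex.I * (b : ℂ)) ^ 2 - 4 * (a : ℂ) := by
    simpa [Complex.conj_ofNat] using congrArg (starRingEnd ℂ) hc₁
  ext z
  rw [spectrum.mem_iff, Matrix.isUnit_iff_isUnit_det, isUnit_iff_ne_zero, not_not,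
    det_scalar_sub_MabC a b ha.le, mul_eq_zero, monic_quadratic_eq_zero_iff hc₁,
    monic_quadratic_eq_zero_iff hc₂]
  simp only [Set.mem_insert_iff, Set.mem_singleton_iff, or_assoc]
end

section
/- For all a > 0 and b ∈ ℝ, the set of complex eigenvalues of M_{a,b} coincides with the set of complex eigenvalues of M_{a,−b}; that is, the spectrum of M_{a,b} does not depend on the sign of b. -/
open Matrix Polynomial

/-- The reflection `(x, y) ↦ (x, -y)` acting on both velocity and position coordinates. -/
def reflection : (Matrix (Fin 4) (Fin 4) ℂ)ˣ where
  val := diagonal ![1, -1, 1, -1]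
  inv := diagonal ![1, -1, 1, -1]
  val_inv := by
    rw [diagonal_mul_diagonal, ← diagonal_one]
    congr 1; ext i; fin_cases i <;> simp
  inv_val := by
    rw [diagonal_mul_diagonal, ← diagonal_one]
    congr 1; ext i; fin_cases i <;> simp

theorem reflection_conj_MabC (a b : ℝ) :
    (reflection : Matrix (Fin 4) (Fin 4) ℂ) * MabC a b * (reflection⁻¹ : _ˣ) = MabC a (-b) := by
  change diagonal ![1, -1, 1, -1] * MabC a b * diagonal ![1, -1, 1, -1] = _
  ext i j
  rw [mul_diagonal, diagonal_mul]
  fin_cases i <;> fin_cases j <;> simp [MabC, Mab]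

/-- For all `a > 0` and `b ∈ ℝ`, the set of complex eigenvalues of `M_{a,b}` coincides with that
of `M_{a,-b}`: the spectrum does not depend on the sign of `b`. -/
theorem stmt_2 (a b : ℝ) (ha : 0 < a) :
    spectrum ℂ (MabC a b) = spectrum ℂ (MabC a (-b)) := by
  rw [← reflection_conj_MabC, spectrum.units_conjugate]
end

section
/- If a > 0 and b ≠ 0, then every complex eigenvalue λ of the matrix M_{a,b} satisfies Im λ ≠ 0. -/
open Matrix Polynomial

/-- The characteristic polynomial of `M_{a,b}`, evaluated at `z`. -/
theorem det_algebraMap_sub_MabC (a b : ℝ) (ha : 0 ≤ a) (z : ℂ) :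
    (algebraMap ℂ (Matrix (Fin 4) (Fin 4) ℂ) z - MabC a b).det =
      (z ^ 2 - z + a) ^ 2 + (b * z) ^ 2 := by
  have hs : (Real.sqrt a : ℂ) ^ 2 = a := by exact_mod_cast Real.sq_sqrt ha
  have hM : algebraMap ℂ (Matrix (Fin 4) (Fin 4) ℂ) z - MabC a b =
      !![z - 1, -(b : ℂ), -(Real.sqrt a : ℂ), 0;
         (b : ℂ), z - 1, 0, -(Real.sqrt a : ℂ);
         (Real.sqrt a : ℂ), 0, z, 0;
         0, (Real.sqrt a : ℂ), 0, z] := by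
    ext i j
    fin_cases i <;> fin_cases j <;> simp [MabC, Mab, Matrix.algebraMap_matrix_apply]
  rw [hM, ← hs]
  simp [Matrix.det_succ_row_zero, Fin.sum_univ_succ, Fin.succAbove]
  ring

/-- If `a > 0` and `b ≠ 0`, then every complex eigenvalue `λ` of `M_{a,b}` has `Im λ ≠ 0`. -/
theorem stmt_3 (a b : ℝ) (ha : 0 < a) (hb : b ≠ 0) :
    ∀ lam ∈ spectrum ℂ (MabC a b), lam.im ≠ 0 := by
  intro lam hlam him
  obtain ⟨x, rfl⟩ : ∃ x : ℝ, (x : ℂ) = lam := ⟨lam.re, Complex.ext rfl him.symm⟩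
  rw [spectrum.mem_iff, Matrix.isUnit_iff_isUnit_det, isUnit_iff_ne_zero, not_not,
    det_algebraMap_sub_MabC a b ha.le] at hlam
  have h : (x ^ 2 - x + a) ^ 2 + (b * x) ^ 2 = 0 := by exact_mod_cast hlam
  have hbx : b * x = 0 := by nlinarith [sq_nonneg (x ^ 2 - x + a), sq_nonneg (b * x)]
  obtain rfl : x = 0 := (mul_eq_zero.mp hbx).resolve_left hb
  have : a ^ 2 = 0 := by simpa using h
  exact ha.ne' (pow_eq_zero_iff two_ne_zero |>.mp this)
end
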